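/- (Retention covariance asymptotics for the random-retained thinning.) Fix λ > 0 and a Borel probability measure F on [0,∞) with ∫ r^d F(dr) < ∞ that follows a power law with tail exponent α > d. Define b(r) = ∫ |B_{r+s}(0)| F(ds), a_u(r₁,r₂) = ∫ |B_{r₁+s}(0) ∩ B_{r₂+s}(u·e₁)| F(ds), and q(u, r₁, r₂) = ∫₀¹∫₀¹ e^{−λ b(r₁)(1−w₁)}·e^{−λ b(r₂)(1−w₂)}·(1{u > r₁+r₂}·e^{λ(1−max(w₁,w₂))·a_u(r₁,r₂)} − 1) dw₁ dw₂. Then for every fixed r₁, r₂ ≥ 0, q(|z|, r₁, r₂)/(q_∞(r₁,r₂)·|z|^d·F̄(|z|)) → 1 as |z| → ∞, where q_∞(r₁,r₂) = λ·c_{α,d}·∫₀¹∫₀¹ (1−max(w₁,w₂))·e^{−λ b(r₁)(1−w₁)}·e^{−λ b(r₂)(1−w₂)} dw₁ dw₂ and c_{α,d} = ∫₀^∞ |B_r(0) ∩ B_r(e₁)|·α·r^{−α−1} dr. -/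

import Mathlib

open MeasureTheory Filter Set Metric ProbabilityTheory

noncomputable section

/-- A measurable positive function is slowly varying at infinity if `ℓ(a t)/ℓ(t) → 1`
as `t → ∞` for every `a > 0`. -/
def SlowlyVarying (ℓ : ℝ → ℝ) : Prop :=
  Measurable ℓ ∧ (∀ x > 0, 0 < ℓ x) ∧
    ∀ a > 0, Tendsto (fun t => ℓ (a * t) / ℓ t) atTop (nhds 1)

/-- Tail function `F̄(x) = F((x,∞))` of a measure on `ℝ`. -/
def tailF (F : Measure ℝ) (x : ℝ) : ℝ := (F (Ioi x)).toReal

/-- `d`-dimensional Euclidean space. -/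
abbrev Euc (d : ℕ) := EuclideanSpace ℝ (Fin d)

/-- The first standard basis vector of `ℝ^d`. -/
def e1 (d : ℕ) : Euc d := if h : 0 < d then EuclideanSpace.single (⟨0, h⟩ : Fin d) 1 else 0

/-- Volume of the closed ball of radius `r` in `ℝ^d`. -/
def ballVol (d : ℕ) (r : ℝ) : ℝ := (volume (closedBall (0 : Euc d) r)).toReal

/-- Volume of the intersection of closed balls `B_r(x)` and `B_s(y)` in `ℝ^d`. -/
def interVol (d : ℕ) (x : Euc d) (r : ℝ) (y : Euc d) (s : ℝ) : ℝ :=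
  (volume (closedBall x r ∩ closedBall y s)).toReal

/-- The constant `c_{α,d} = ∫₀^∞ |B_r(0) ∩ B_r(e₁)| α r^{-α-1} dr`. -/
def cconst (d : ℕ) (α : ℝ) : ℝ :=
  ∫ r in Ioi (0 : ℝ), interVol d 0 r (e1 d) r * (α * r ^ (-α - 1))

/-- `F` follows a power law with tail exponent `α`: `F̄(r) = ℓ(r) r^{-α}` with `ℓ`
slowly varying. -/
def IsPowerLaw (F : Measure ℝ) (α : ℝ) : Prop :=
  ∃ ℓ : ℝ → ℝ, SlowlyVarying ℓ ∧ ∀ x > 0, tailF F x = ℓ x * x ^ (-α)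

/-- `b(r) = ∫ |B_{r+s}(0)| F(ds)`. -/
def bR (d : ℕ) (F : Measure ℝ) (r : ℝ) : ℝ := ∫ s, ballVol d (r + s) ∂F

/-- Weight-averaged retention probability for the random-retained (Matérn type II)
thinning. -/
def hR (d : ℕ) (lam : ℝ) (F : Measure ℝ) (r : ℝ) : ℝ :=
  (1 - Real.exp (-(lam * bR d F r))) / (lam * bR d F r)

/-- `a_u(r₁,r₂) = ∫ |B_{r₁+s}(0) ∩ B_{r₂+s}(u e₁)| F(ds)`. -/
def aR (d : ℕ) (F : Measure ℝ) (u r₁ r₂ : ℝ) : ℝ :=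
  ∫ s, interVol d 0 (r₁ + s) (u • e1 d) (r₂ + s) ∂F

/-- Retention covariance for the random-retained thinning. -/
def qR (d : ℕ) (lam : ℝ) (F : Measure ℝ) (u r₁ r₂ : ℝ) : ℝ :=
  ∫ w₁ in (0:ℝ)..1, ∫ w₂ in (0:ℝ)..1,
    Real.exp (-(lam * bR d F r₁ * (1 - w₁))) * Real.exp (-(lam * bR d F r₂ * (1 - w₂))) *
      ((if r₁ + r₂ < u then Real.exp (lam * (1 - max w₁ w₂) * aR d F u r₁ r₂) else 0) - 1)

/-- Limit function `q_∞(r₁,r₂)` for the random-retained thinning. -/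
def qinfR (d : ℕ) (lam α : ℝ) (F : Measure ℝ) (r₁ r₂ : ℝ) : ℝ :=
  lam * cconst d α * ∫ w₁ in (0:ℝ)..1, ∫ w₂ in (0:ℝ)..1,
    (1 - max w₁ w₂) * Real.exp (-(lam * bR d F r₁ * (1 - w₁))) *
      Real.exp (-(lam * bR d F r₂ * (1 - w₂)))

lemma tailF_antitone (F : Measure ℝ) [IsProbabilityMeasure F] : Antitone (tailF F) := by
  intro x y hxy
  exact measureReal_mono (μ := F) (Ioi_subset_Ioi hxy)

lemma tailF_pos {F : Measure ℝ} {α : ℝ} (h : IsPowerLaw F α) {x : ℝ} (hx : 0 < x) :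
    0 < tailF F x := by
  obtain ⟨ℓ, ⟨_, h2, _⟩, h4⟩ := h
  rw [h4 x hx]
  exact mul_pos (h2 x hx) (Real.rpow_pos_of_pos hx _)

lemma tailF_ratio {F : Measure ℝ} {α : ℝ} (h : IsPowerLaw F α) {a : ℝ} (ha : 0 < a) :
    Tendsto (fun u => tailF F (a * u) / tailF F u) atTop (nhds (a ^ (-α))) := by
  obtain ⟨ℓ, ⟨_, h2, h3⟩, h4⟩ := h
  have := (h3 a ha).mul_const (a ^ (-α))
  rw [one_mul] at this
  refine this.congr' ?_
  filter_upwards [eventually_gt_atTop 0] with u hu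
  rw [h4 u hu, h4 (a * u) (mul_pos ha hu), Real.mul_rpow ha.le hu.le]
  have := (h2 u hu).ne'
  have := (Real.rpow_pos_of_pos hu (-α)).ne'
  field_simp

lemma potter {F : Measure ℝ} [IsProbabilityMeasure F] {α β : ℝ} (h : IsPowerLaw F α)
    (hβ : β < α) (hβ0 : 0 < β) :
    ∃ u0 > 0, ∀ u ≥ u0, ∀ κ ≥ 1, tailF F (κ * u) ≤ 2 ^ β * κ ^ (-β) * tailF F u := by
  have h1 := tailF_ratio h (a := 2) (by norm_num)
  have h2 : (2:ℝ) ^ (-α) < 2 ^ (-β) := Real.rpow_lt_rpow_of_exponent_lt (by norm_num) (by linarith)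
  obtain ⟨u1, hu1⟩ := eventually_atTop.1 (h1.eventually (gt_mem_nhds h2))
  refine ⟨max u1 1, by positivity, fun u hu κ hκ => ?_⟩
  have hu0 : 0 < u := by linarith [le_max_right u1 1]
  have hu1' : u1 ≤ u := (le_max_left u1 1).trans hu
  have key : ∀ n : ℕ, tailF F (2 ^ n * u) ≤ ((2:ℝ) ^ (-β)) ^ n * tailF F u := by
    intro n
    induction n with
    | zero => simp
    | succ n ih =>
      have hge : u ≤ 2 ^ n * u := le_mul_of_one_le_left hu0.le (one_le_pow₀ (by norm_num))
      have h3 := hu1 (2 ^ n * u) (hu1'.trans hge)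
      rw [div_lt_iff₀ (tailF_pos h (by positivity))] at h3
      have e : (2:ℝ) ^ (n+1) * u = 2 * (2 ^ n * u) := by ring
      rw [e, pow_succ']
      refine h3.le.trans ?_
      rw [mul_assoc]
      exact mul_le_mul_of_nonneg_left ih (by positivity)
  obtain ⟨n, hn1, hn2⟩ := exists_nat_pow_near hκ (y := (2:ℝ)) (by norm_num)
  have hκ0 : 0 < κ := by linarith
  have h5 : ((2:ℝ) ^ (-β)) ^ n ≤ 2 ^ β * κ ^ (-β) := by
    have h6 : ((2:ℝ) ^ (n+1)) ^ (-β) ≤ κ ^ (-β) :=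
      Real.rpow_le_rpow_of_nonpos hκ0 hn2.le (by linarith)
    have h7 : ((2:ℝ) ^ (n+1)) ^ (-β) = ((2:ℝ) ^ (-β)) ^ (n+1) := by
      rw [← Real.rpow_natCast, ← Real.rpow_natCast, ← Real.rpow_mul (by norm_num),
        ← Real.rpow_mul (by norm_num), mul_comm]
    rw [h7] at h6
    calc ((2:ℝ) ^ (-β)) ^ n = 2 ^ β * ((2:ℝ) ^ (-β)) ^ (n+1) := by
          rw [pow_succ', ← mul_assoc, ← Real.rpow_add (by norm_num)]; simp
      _ ≤ _ := mul_le_mul_of_nonneg_left h6 (by positivity)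
  calc tailF F (κ * u) ≤ tailF F (2 ^ n * u) :=
        tailF_antitone F (mul_le_mul_of_nonneg_right hn1 hu0.le)
    _ ≤ _ := key n
    _ ≤ _ := mul_le_mul_of_nonneg_right h5 (tailF_pos h hu0).le

lemma upper_ratio {F : Measure ℝ} [IsProbabilityMeasure F] {α : ℝ} (h : IsPowerLaw F α)
    {ρ κ : ℝ} (hρ : 0 ≤ ρ) (hκ : 0 < κ) {S : Set ℝ} (hS1 : Ioi κ ⊆ S) (hS2 : S ⊆ Ici κ) :
    Tendsto (fun u => F.real {s | (ρ + s) / u ∈ S} / tailF F u) atTop (nhds (κ ^ (-α))) := by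
  rw [tendsto_order]
  constructor
  · intro a ha
    filter_upwards [(tailF_ratio h hκ).eventually (lt_mem_nhds ha), eventually_gt_atTop 0] with u h1 hu
    refine h1.trans_le (div_le_div_of_nonneg_right ?_ (tailF_pos h hu).le)
    refine measureReal_mono (μ := F) ?_
    intro s hs
    apply hS1
    simp only [mem_Ioi] at *
    rw [lt_div_iff₀ hu]; linarith
  · intro a ha
    have hc : ContinuousAt (fun x : ℝ => x ^ (-α)) κ :=
      Real.continuousAt_rpow_const _ _ (Or.inl hκ.ne')
    have hev := hc.eventually (gt_mem_nhds ha)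
    obtain ⟨ε, hε, hball⟩ := Metric.eventually_nhds_iff.1 hev
    set κ' := κ - min (ε/2) (κ/2) with hκ'
    have hm : 0 < min (ε/2) (κ/2) := by positivity
    have hm1 := min_le_left (ε/2) (κ/2)
    have hm2 := min_le_right (ε/2) (κ/2)
    have hκ'0 : 0 < κ' := by linarith
    have hlt : κ' ^ (-α) < a := by
      apply hball
      rw [Real.dist_eq, abs_lt]; constructor <;> linarith
    filter_upwards [(tailF_ratio h hκ'0).eventually (gt_mem_nhds hlt), eventually_gt_atTop 0,
      eventually_gt_atTop (ρ / min (ε/2) (κ/2))] with u h1 hu hu2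
    refine lt_of_le_of_lt (div_le_div_of_nonneg_right ?_ (tailF_pos h hu).le) h1
    refine measureReal_mono (μ := F) ?_
    intro s hs
    have := hS2 hs
    simp only [mem_Ici, mem_Ioi] at *
    rw [le_div_iff₀ hu] at this
    rw [div_lt_iff₀ hm] at hu2
    rw [hκ']; nlinarith

lemma upper_bound {F : Measure ℝ} [IsProbabilityMeasure F] {α β : ℝ} (h : IsPowerLaw F α)
    (hβ : β < α) (hβ0 : 0 < β) {ρ : ℝ} (_hρ : 0 ≤ ρ) :
    ∃ C > 0, ∀ᶠ u in atTop, ∀ m ≥ (1/2 : ℝ),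
      F.real {s | m ≤ (ρ + s) / u} / tailF F u ≤ C * m ^ (-β) := by
  obtain ⟨u0, hu0, hp⟩ := potter h hβ hβ0
  have h8 := tailF_ratio h (a := 1/8) (by norm_num)
  have hlt : (1/8:ℝ) ^ (-α) < (1/8:ℝ) ^ (-α) + 1 := by linarith
  have hpos : 0 < (1/8:ℝ) ^ (-α) + 1 := by positivity
  refine ⟨2 ^ β * 2 ^ (-β) * ((1/8:ℝ) ^ (-α) + 1), by positivity, ?_⟩
  filter_upwards [h8.eventually (gt_mem_nhds hlt), eventually_gt_atTop 0,
    eventually_ge_atTop (8 * u0), eventually_ge_atTop (4 * ρ)] with u h1 hu hu1 hu2 m hm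
  have htp := tailF_pos h hu
  rw [div_lt_iff₀ htp] at h1
  rw [div_le_iff₀ htp]
  have hsub : F.real {s | m ≤ (ρ + s) / u} ≤ tailF F ((2 * m) * (1/8 * u)) := by
    refine measureReal_mono (μ := F) ?_
    intro s hs
    simp only [Set.mem_ofPred_eq, mem_Ioi] at *
    rw [le_div_iff₀ hu] at hs
    nlinarith
  have h2 := hp (1/8 * u) (by linarith) (2 * m) (by linarith)
  rw [Real.mul_rpow (by norm_num) (by linarith)] at h2
  have hmp : 0 < m ^ (-β) := Real.rpow_pos_of_pos (by linarith) _
  calc _ ≤ _ := hsub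
    _ ≤ _ := h2
    _ ≤ 2 ^ β * (2 ^ (-β) * m ^ (-β)) * (((1/8:ℝ) ^ (-α) + 1) * tailF F u) :=
      mul_le_mul_of_nonneg_left h1.le (by positivity)
    _ = _ := by ring

/-- The properties of the kernel `K(r) = |B_r(0) ∩ B_r(e₁)|` which are used. -/
structure GoodK (d : ℕ) (ω : ℝ) (K : ℝ → ℝ) : Prop where
  mono : Monotone K
  nonneg : ∀ r, 0 ≤ K r
  zero : ∀ r < 1/2, K r = 0
  le : ∀ r ≥ 0, K r ≤ ω * r ^ d
  unbdd : ∀ t, ∃ r, t < K r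

lemma GoodK.exists_kappa {d : ℕ} {ω : ℝ} {K : ℝ → ℝ} (hK : GoodK d ω K) {t : ℝ} (ht : 0 < t) :
    ∃ κ ≥ (1/2 : ℝ), Ioi κ ⊆ {r | t < K r} ∧ {r | t < K r} ⊆ Ici κ := by
  have hlb : ∀ r ∈ {r | t < K r}, 1/2 ≤ r := by
    intro r hr
    by_contra! hlt
    have hr' : t < K r := hr
    rw [hK.zero r hlt] at hr'
    linarith
  have hne : {r | t < K r}.Nonempty := hK.unbdd t
  have hbb : BddBelow {r | t < K r} := ⟨1/2, hlb⟩
  refine ⟨sInf {r | t < K r}, le_csInf hne hlb, ?_, fun r hr => csInf_le hbb hr⟩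
  intro r hr
  obtain ⟨s, hs, hsr⟩ := (csInf_lt_iff hbb hne).1 hr
  exact lt_of_lt_of_le (show t < K s from hs) (hK.mono hsr.le)

/-- The limiting measure with density `α r^{-α-1}`. -/
def limMeas (α : ℝ) : Measure ℝ :=
  (volume.restrict (Ioi (0:ℝ))).withDensity (fun r => ENNReal.ofReal (α * r ^ (-α - 1)))

lemma limMeas_dens_meas (α : ℝ) :
    Measurable (fun r : ℝ => ENNReal.ofReal (α * r ^ (-α - 1))) := by fun_prop

lemma limMeas_tail {α κ : ℝ} (hα : 0 < α) (hκ : 0 < κ) {S : Set ℝ} (hS1 : Ioi κ ⊆ S)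
    (hS2 : S ⊆ Ici κ) : (limMeas α).real S = κ ^ (-α) := by
  have hac : limMeas α ≪ volume :=
    (withDensity_absolutelyContinuous _ _).trans Measure.absolutelyContinuous_restrict
  have h0 : (limMeas α) (Ici κ) = (limMeas α) (Ioi κ) :=
    measure_congr (hac.ae_le (Ioi_ae_eq_Ici (μ := volume) (a := κ)).symm)
  have h1 : (limMeas α) S = (limMeas α) (Ioi κ) :=
    le_antisymm ((measure_mono hS2).trans h0.le) (measure_mono hS1)
  rw [Measure.real, h1, limMeas, withDensity_apply _ measurableSet_Ioi,
    Measure.restrict_restrict measurableSet_Ioi,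
    inter_eq_left.2 (Ioi_subset_Ioi hκ.le)]
  have hIntg : IntegrableOn (fun r : ℝ => α * r ^ (-α - 1)) (Ioi κ) :=
    (integrableOn_Ioi_rpow_of_lt (by linarith) hκ).const_mul α
  rw [← ofReal_integral_eq_lintegral_ofReal hIntg, ENNReal.toReal_ofReal]
  · rw [integral_const_mul, integral_Ioi_rpow_of_lt (by linarith) hκ]
    have : -α - 1 + 1 = -α := by ring
    rw [this]; field_simp
  · refine setIntegral_nonneg measurableSet_Ioi (fun x hx => ?_)
    have : 0 < x := hκ.trans hx
    positivity
  · filter_upwards [ae_restrict_mem measurableSet_Ioi] with x hx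
    have : 0 < x := hκ.trans hx
    simp only [Pi.zero_apply]
    positivity

lemma GoodK.integrableOn {d : ℕ} {ω α : ℝ} {K : ℝ → ℝ} (hK : GoodK d ω K) (hα : (d:ℝ) < α) :
    IntegrableOn (fun r => K r * (α * r ^ (-α - 1))) (Ioi 0) := by
  have hα0 : 0 < α := lt_of_le_of_lt (Nat.cast_nonneg d) hα
  rw [← Ioc_union_Ioi_eq_Ioi (show (0:ℝ) ≤ 1/4 by norm_num)]
  refine IntegrableOn.union ?_ ?_
  · refine (integrableOn_zero (ε' := ℝ)).congr_fun (fun r hr => ?_) measurableSet_Ioc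
    rw [hK.zero r (by linarith [hr.2]), zero_mul]
  · have hg : IntegrableOn (fun r : ℝ => (ω * α) * r ^ ((d:ℝ) - α - 1)) (Ioi (1/4)) :=
      (integrableOn_Ioi_rpow_of_lt (by linarith) (by norm_num)).const_mul _
    refine Integrable.mono' hg ?_ ?_
    · exact (hK.mono.measurable.mul (by fun_prop)).aestronglyMeasurable
    · filter_upwards [ae_restrict_mem measurableSet_Ioi] with r hr
      have hr0 : 0 < r := lt_trans (by norm_num) hr
      have hp : 0 < r ^ (-α - 1) := Real.rpow_pos_of_pos hr0 _
      rw [Real.norm_of_nonneg (mul_nonneg (hK.nonneg r) (by positivity))]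
      calc K r * (α * r ^ (-α - 1)) ≤ (ω * r ^ d) * (α * r ^ (-α - 1)) :=
            mul_le_mul_of_nonneg_right (hK.le r hr0.le) (by positivity)
        _ = (ω * α) * (r ^ ((d:ℝ)) * r ^ (-α - 1)) := by rw [Real.rpow_natCast]; ring
        _ = _ := by rw [← Real.rpow_add hr0]; congr 2; ring

lemma GoodK.lim_eq {d : ℕ} {ω α : ℝ} {K : ℝ → ℝ} (hK : GoodK d ω K) (hα : (d:ℝ) < α) :
    ∫ r in Ioi 0, K r * (α * r ^ (-α - 1)) = ∫ t in Ioi 0, (limMeas α).real {r | t < K r} := by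
  have hα0 : 0 < α := lt_of_le_of_lt (Nat.cast_nonneg d) hα
  have hfin : ∀ᵐ r ∂(volume.restrict (Ioi (0:ℝ))), ENNReal.ofReal (α * r ^ (-α - 1)) < ⊤ :=
    ae_of_all _ fun r => ENNReal.ofReal_lt_top
  have hcong : ∀ r ∈ Ioi (0:ℝ), K r * (α * r ^ (-α - 1)) =
      (ENNReal.ofReal (α * r ^ (-α - 1))).toReal • K r := by
    intro r hr
    have hp : 0 < r ^ (-α - 1) := Real.rpow_pos_of_pos hr _
    rw [ENNReal.toReal_ofReal (by positivity), smul_eq_mul, mul_comm]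
  have hIntg : Integrable K (limMeas α) := by
    rw [limMeas, integrable_withDensity_iff_integrable_smul' (limMeas_dens_meas α) hfin]
    exact (hK.integrableOn hα).congr_fun hcong measurableSet_Ioi
  rw [← hIntg.integral_eq_integral_meas_lt (ae_of_all _ hK.nonneg), limMeas,
    integral_withDensity_eq_integral_toReal_smul (limMeas_dens_meas α) hfin]
  exact setIntegral_congr_fun measurableSet_Ioi hcong

lemma GoodK.integrable_F {d : ℕ} {ω : ℝ} {K : ℝ → ℝ} (hK : GoodK d ω K) (hω : 0 < ω)
    {F : Measure ℝ} [IsProbabilityMeasure F] (hmom : Integrable (fun r : ℝ => r ^ d) F)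
    {ρ u : ℝ} (hu : 0 < u) : Integrable (fun s => K ((ρ + s) / u)) F := by
  have hg : Integrable (fun s : ℝ => ω * (2 ^ (d - 1) * (|ρ| ^ d + |s ^ d|) / u ^ d)) F :=
    ((((integrable_const _).add hmom.abs).const_mul _).div_const _).const_mul _
  refine Integrable.mono' hg ?_ ?_
  · exact (hK.mono.measurable.comp (by fun_prop)).aestronglyMeasurable
  · refine ae_of_all _ fun s => ?_
    rw [Real.norm_of_nonneg (hK.nonneg _)]
    have h1 : K ((ρ + s) / u) ≤ K ((|ρ| + |s|) / u) :=
      hK.mono (div_le_div_of_nonneg_right (add_le_add (le_abs_self _) (le_abs_self _)) hu.le)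
    refine h1.trans ((hK.le _ (by positivity)).trans ?_)
    refine mul_le_mul_of_nonneg_left ?_ hω.le
    rw [div_pow, abs_pow]
    exact div_le_div_of_nonneg_right (add_pow_le (abs_nonneg _) (abs_nonneg _) d) (by positivity)

lemma GoodK.tendsto {d : ℕ} (hd : 0 < d) {ω α : ℝ} {K : ℝ → ℝ} (hK : GoodK d ω K) (hω : 0 < ω)
    {F : Measure ℝ} [IsProbabilityMeasure F] (hmom : Integrable (fun r : ℝ => r ^ d) F)
    (hα : (d:ℝ) < α) (hpow : IsPowerLaw F α) {ρ : ℝ} (hρ : 0 ≤ ρ) :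
    Tendsto (fun u => (∫ s, K ((ρ + s) / u) ∂F) / tailF F u) atTop
      (nhds (∫ r in Ioi 0, K r * (α * r ^ (-α - 1)))) := by
  have hα0 : 0 < α := lt_of_le_of_lt (Nat.cast_nonneg d) hα
  have hd0 : (0:ℝ) < d := by exact_mod_cast hd
  obtain ⟨β, hβ1, hβ2⟩ := exists_between hα
  have hβ0 : 0 < β := hd0.trans hβ1
  obtain ⟨C, hC, hbd⟩ := upper_bound hpow hβ2 hβ0 hρ
  rw [hK.lim_eq hα]
  have hmain : Tendsto (fun u => ∫ t in Ioi 0, F.real {s | t < K ((ρ + s) / u)} / tailF F u) atTop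
      (nhds (∫ t in Ioi 0, (limMeas α).real {r | t < K r})) := by
    refine tendsto_integral_filter_of_dominated_convergence
      (fun t => if t ≤ ω then C * (1/2:ℝ) ^ (-β) else C * ω ^ (β / d) * t ^ (-(β / d))) ?_ ?_ ?_ ?_
    · refine Eventually.of_forall fun u => Measurable.aestronglyMeasurable ?_
      refine Measurable.div_const ?_ _
      refine Antitone.measurable fun t t' htt' => ?_
      refine measureReal_mono (μ := F) fun s hs => ?_
      exact lt_of_le_of_lt htt' hs
    · filter_upwards [hbd, eventually_gt_atTop 0] with u hb hu
      filter_upwards [ae_restrict_mem measurableSet_Ioi] with t ht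
      have ht0 : 0 < t := ht
      have htp := tailF_pos hpow hu
      rw [Real.norm_of_nonneg (by positivity)]
      have hhalf : ∀ r, t < K r → 1/2 ≤ r := by
        intro r hr
        by_contra! hlt
        rw [hK.zero r hlt] at hr
        linarith
      split_ifs with htω
      · refine le_trans ?_ (hb (1/2) le_rfl)
        refine div_le_div_of_nonneg_right (measureReal_mono (μ := F) fun s hs => ?_) htp.le
        exact hhalf _ hs
      · push Not at htω
        have hge1 : 1 ≤ t / ω := by rw [le_div_iff₀ hω]; linarith
        have hm : 1 ≤ (t / ω) ^ (1 / (d:ℝ)) := Real.one_le_rpow hge1 (by positivity)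
        have e : C * ω ^ (β / d) * t ^ (-(β / d)) = C * ((t / ω) ^ (1 / (d:ℝ))) ^ (-β) := by
          rw [← Real.rpow_mul (by positivity), Real.div_rpow ht0.le hω.le]
          have : 1 / (d:ℝ) * -β = -(β / d) := by ring
          rw [this, Real.rpow_neg hω.le (β / d), div_inv_eq_mul]; ring
        rw [e]
        refine le_trans ?_ (hb _ (by linarith))
        refine div_le_div_of_nonneg_right (measureReal_mono (μ := F) fun s hs => ?_) htp.le
        have hs' : t < K ((ρ + s) / u) := hs
        have hr := hhalf _ hs'
        have hr0 : 0 ≤ (ρ + s) / u := by linarith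
        have h1 := hs'.le.trans (hK.le _ hr0)
        show (t / ω) ^ (1 / (d:ℝ)) ≤ (ρ + s) / u
        rw [one_div, Real.rpow_inv_le_iff_of_pos (by positivity) hr0 hd0, Real.rpow_natCast,
          div_le_iff₀ hω]
        linarith
    · change IntegrableOn _ (Ioi 0) volume
      rw [← Ioc_union_Ioi_eq_Ioi hω.le]
      refine IntegrableOn.union ?_ ?_
      · refine (integrableOn_const (C := C * (1/2:ℝ) ^ (-β)) (by simp)).congr_fun
          (fun t ht => ?_) measurableSet_Ioc
        simp [ht.2]
      · have hg : IntegrableOn (fun t : ℝ => C * ω ^ (β / d) * t ^ (-(β / d))) (Ioi ω) := by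
          refine (integrableOn_Ioi_rpow_of_lt ?_ hω).const_mul _
          have : 1 < β / d := by rw [lt_div_iff₀ hd0]; linarith
          linarith
        refine hg.congr_fun (fun t ht => ?_) measurableSet_Ioi
        simp only [not_le.2 (mem_Ioi.1 ht), if_false]
    · filter_upwards [ae_restrict_mem measurableSet_Ioi] with t ht
      obtain ⟨κ, hκ, h1, h2⟩ := hK.exists_kappa ht
      have hκ0 : 0 < κ := by linarith
      rw [limMeas_tail hα0 hκ0 h1 h2]
      have h3 := upper_ratio hpow hρ hκ0 h1 h2
      simp only [Set.mem_ofPred_eq] at h3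
      exact h3
  refine hmain.congr' ?_
  filter_upwards [eventually_gt_atTop 0] with u hu
  rw [(hK.integrable_F hω hmom hu).integral_eq_integral_meas_lt (ae_of_all _ fun s => hK.nonneg _),
    integral_div]

lemma norm_e1 {d : ℕ} (hd : 0 < d) : ‖e1 d‖ = 1 := by
  simp [e1, hd]

lemma interVol_mono {d : ℕ} (x y : Euc d) {r r' s s' : ℝ} (hr : r ≤ r') (hs : s ≤ s') :
    interVol d x r y s ≤ interVol d x r' y s' := by
  refine measureReal_mono (μ := volume)
    (inter_subset_inter (closedBall_subset_closedBall hr) (closedBall_subset_closedBall hs)) ?_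
  exact ((measure_mono inter_subset_left).trans_lt measure_closedBall_lt_top).ne

lemma goodK {d : ℕ} (hd : 0 < d) :
    GoodK d (volume.real (ball (0 : Euc d) 1)) (fun r => interVol d 0 r (e1 d) r) where
  mono := fun _ _ h => interVol_mono _ _ h h
  nonneg := fun _ => ENNReal.toReal_nonneg
  zero := by
    intro r hr
    have : closedBall (0 : Euc d) r ∩ closedBall (e1 d) r = ∅ := by
      rw [Set.eq_empty_iff_forall_notMem]
      rintro x ⟨h1, h2⟩
      have h3 := dist_triangle_left (0 : Euc d) (e1 d) x
      rw [dist_zero_left, norm_e1 hd] at h3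
      rw [mem_closedBall] at h1 h2
      linarith
    simp [interVol, this]
  le := by
    intro r hr
    have h := Measure.addHaar_real_closedBall (volume : Measure (Euc d)) 0 hr
    rw [finrank_euclideanSpace_fin] at h
    rw [mul_comm, ← h]
    exact measureReal_mono (μ := volume) inter_subset_left measure_closedBall_lt_top.ne
  unbdd := by
    intro t
    have hω : 0 < volume.real (ball (0 : Euc d) 1) :=
      ENNReal.toReal_pos (measure_ball_pos _ _ one_pos).ne' measure_ball_lt_top.ne
    set ω := volume.real (ball (0 : Euc d) 1) with hωdef
    refine ⟨2 + |t| / ω, ?_⟩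
    have hq : 0 ≤ |t| / ω := by positivity
    have h := Measure.addHaar_real_closedBall (volume : Measure (Euc d)) 0
      (show 0 ≤ 1 + |t| / ω by positivity)
    rw [finrank_euclideanSpace_fin, ← hωdef] at h
    have h1 : volume.real (closedBall (0 : Euc d) (1 + |t| / ω)) ≤
        interVol d 0 (2 + |t| / ω) (e1 d) (2 + |t| / ω) := by
      refine measureReal_mono (μ := volume) (subset_inter ?_ ?_)
        ((measure_mono inter_subset_left).trans_lt measure_closedBall_lt_top).ne
      · exact closedBall_subset_closedBall (by linarith)
      · apply closedBall_subset_closedBall'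
        rw [dist_zero_left, norm_e1 hd]; linarith
    refine lt_of_lt_of_le ?_ h1
    rw [h]
    have h2 : 1 + |t| / ω ≤ (1 + |t| / ω) ^ d := le_self_pow₀ (by linarith) hd.ne'
    have h3 : (1 + |t| / ω) * ω = ω + |t| := by field_simp
    calc t ≤ |t| := le_abs_self t
      _ < (1 + |t| / ω) * ω := by rw [h3]; linarith
      _ ≤ _ := mul_le_mul_of_nonneg_right h2 hω.le

open scoped Pointwise in
lemma interVol_scale {d : ℕ} {u : ℝ} (hu : 0 < u) (r : ℝ) :
    interVol d 0 r (u • e1 d) r = u ^ d * interVol d 0 (r / u) (e1 d) (r / u) := by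
  have h : closedBall (0 : Euc d) r ∩ closedBall (u • e1 d) r =
      u • (closedBall (0 : Euc d) (r / u) ∩ closedBall (e1 d) (r / u)) := by
    rw [Set.smul_set_inter₀ hu.ne', smul_closedBall' hu.ne', smul_closedBall' hu.ne',
      Real.norm_of_nonneg hu.le, smul_zero, mul_div_cancel₀ _ hu.ne']
  rw [interVol, h, Measure.addHaar_smul, finrank_euclideanSpace_fin, ENNReal.toReal_mul,
    ENNReal.toReal_ofReal (abs_nonneg _), abs_of_nonneg (by positivity)]
  rfl

lemma aR_tendsto {d : ℕ} (hd : 0 < d) {F : Measure ℝ} [IsProbabilityMeasure F]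
    (hmom : Integrable (fun r : ℝ => r ^ d) F)
    {α : ℝ} (hα : (d : ℝ) < α) (hpow : IsPowerLaw F α)
    {r₁ r₂ : ℝ} (hr₁ : 0 ≤ r₁) (hr₂ : 0 ≤ r₂) :
    Tendsto (fun u => aR d F u r₁ r₂ / (u ^ d * tailF F u)) atTop (nhds (cconst d α)) := by
  have hω : 0 < volume.real (ball (0 : Euc d) 1) :=
    ENNReal.toReal_pos (measure_ball_pos _ _ one_pos).ne' measure_ball_lt_top.ne
  have hK := goodK hd
  have hl := hK.tendsto hd hω hmom hα hpow (le_refl (0:ℝ))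
  have hu := hK.tendsto hd hω hmom hα hpow (le_trans hr₁ (le_max_left r₁ r₂))
  have hpt : ∀ u > 0, ∀ s, interVol d 0 (r₁ + s) (u • e1 d) (r₂ + s) ≤
      u ^ d * interVol d 0 ((max r₁ r₂ + s) / u) (e1 d) ((max r₁ r₂ + s) / u) := by
    intro u hu s
    rw [← interVol_scale hu]
    exact interVol_mono _ _ (by gcongr; exact le_max_left _ _) (by gcongr; exact le_max_right _ _)
  have hpt' : ∀ u > 0, ∀ s, u ^ d * interVol d 0 ((0 + s) / u) (e1 d) ((0 + s) / u) ≤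
      interVol d 0 (r₁ + s) (u • e1 d) (r₂ + s) := by
    intro u hu s
    rw [← interVol_scale hu]
    exact interVol_mono _ _ (by linarith) (by linarith)
  have hIntg : ∀ u : ℝ, u > 0 → Integrable (fun s => interVol d 0 (r₁ + s) (u • e1 d) (r₂ + s)) F := by
    intro u hu
    refine Integrable.mono' ((hK.integrable_F hω hmom hu (ρ := max r₁ r₂)).const_mul (u ^ d)) ?_ ?_
    · refine (Monotone.measurable fun s s' h => ?_).aestronglyMeasurable
      exact interVol_mono _ _ (by linarith) (by linarith)
    · refine ae_of_all _ fun s => ?_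
      rw [Real.norm_of_nonneg (show 0 ≤ interVol d 0 (r₁ + s) (u • e1 d) (r₂ + s) from ENNReal.toReal_nonneg)]
      exact hpt u hu s
  refine tendsto_of_tendsto_of_tendsto_of_le_of_le' hl hu ?_ ?_
  · filter_upwards [eventually_gt_atTop 0] with u hu
    have htp := tailF_pos hpow hu
    have hud : 0 < u ^ d := by positivity
    rw [div_le_div_iff₀ htp (by positivity)]
    have := integral_mono ((hK.integrable_F hω hmom hu (ρ := 0)).const_mul (u ^ d)) (hIntg u hu)
      (hpt' u hu)
    rw [integral_const_mul] at this
    calc _ = (u ^ d * ∫ s, interVol d 0 ((0 + s) / u) (e1 d) ((0 + s) / u) ∂F) * tailF F u := by ring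
      _ ≤ _ := mul_le_mul_of_nonneg_right this htp.le
  · filter_upwards [eventually_gt_atTop 0] with u hu
    have htp := tailF_pos hpow hu
    have hud : 0 < u ^ d := by positivity
    rw [div_le_div_iff₀ (by positivity) htp]
    have := integral_mono (hIntg u hu)
      ((hK.integrable_F hω hmom hu (ρ := max r₁ r₂)).const_mul (u ^ d)) (hpt u hu)
    rw [integral_const_mul] at this
    calc _ ≤ (u ^ d * ∫ s, interVol d 0 ((max r₁ r₂ + s) / u) (e1 d) ((max r₁ r₂ + s) / u) ∂F)
            * tailF F u := mul_le_mul_of_nonneg_right this htp.le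
      _ = _ := by ring

lemma cconst_pos {d : ℕ} (hd : 0 < d) {α : ℝ} (hα : (d : ℝ) < α) : 0 < cconst d α := by
  have hα0 : 0 < α := lt_of_le_of_lt (Nat.cast_nonneg d) hα
  have hK := goodK hd
  obtain ⟨r0, hr0⟩ := hK.unbdd 0
  rw [cconst, setIntegral_pos_iff_support_of_nonneg_ae _ (hK.integrableOn hα)]
  · refine lt_of_lt_of_le (b := volume (Ioi (max r0 0))) (by simp) (measure_mono fun r hr => ?_)
    have hr1 : r0 < r := (le_max_left _ _).trans_lt hr
    have hr2 : 0 < r := (le_max_right _ _).trans_lt hr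
    refine ⟨?_, hr2⟩
    have h1 : 0 < interVol d 0 r (e1 d) r := lt_of_lt_of_le hr0 (hK.mono hr1.le)
    have hp : 0 < r ^ (-α - 1) := Real.rpow_pos_of_pos hr2 _
    exact (mul_pos h1 (mul_pos hα0 hp)).ne'
  · filter_upwards [ae_restrict_mem measurableSet_Ioi] with x hx
    have hp : 0 < x ^ (-α - 1) := Real.rpow_pos_of_pos hx _
    exact mul_nonneg (hK.nonneg x) (by positivity)

lemma scale_tendsto_zero {d : ℕ} {F : Measure ℝ} [IsProbabilityMeasure F]
    {α : ℝ} (hα : (d : ℝ) < α) (hpow : IsPowerLaw F α) :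
    Tendsto (fun u => u ^ d * tailF F u) atTop (nhds 0) := by
  obtain ⟨β, hβ1, hβ2⟩ := exists_between hα
  have hβ0 : 0 < β := lt_of_le_of_lt (Nat.cast_nonneg d) hβ1
  obtain ⟨u0, hu0, hp⟩ := potter hpow hβ2 hβ0
  have hlim : Tendsto (fun u : ℝ => (2 ^ β * (u0⁻¹) ^ (-β) * tailF F u0) * u ^ (-(β - d))) atTop
      (nhds ((2 ^ β * (u0⁻¹) ^ (-β) * tailF F u0) * 0)) :=
    (tendsto_rpow_neg_atTop (by linarith)).const_mul _
  rw [mul_zero] at hlim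
  refine tendsto_of_tendsto_of_tendsto_of_le_of_le' tendsto_const_nhds hlim ?_ ?_
  · filter_upwards [eventually_gt_atTop 0] with u hu
    exact mul_nonneg (by positivity) (tailF_pos hpow hu).le
  · filter_upwards [eventually_ge_atTop u0] with u hu
    have hu1 : 0 < u := hu0.trans_le hu
    have h1 := hp u0 le_rfl (u0⁻¹ * u) (by
      rw [ge_iff_le, inv_mul_eq_div, le_div_iff₀ hu0]; linarith)
    have e : u0⁻¹ * u * u0 = u := by field_simp
    rw [e, Real.mul_rpow (by positivity) hu1.le] at h1
    calc u ^ d * tailF F u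
        ≤ u ^ d * (2 ^ β * ((u0⁻¹) ^ (-β) * u ^ (-β)) * tailF F u0) :=
          mul_le_mul_of_nonneg_left h1 (by positivity)
      _ = (2 ^ β * (u0⁻¹) ^ (-β) * tailF F u0) * (u ^ (d:ℝ) * u ^ (-β)) := by
          rw [Real.rpow_natCast]; ring
      _ = _ := by rw [← Real.rpow_add hu1]; congr 2; ring

/-- The double integral in `q_∞`. -/
def dblI (p q : ℝ) : ℝ := ∫ w₁ in (0:ℝ)..1, ∫ w₂ in (0:ℝ)..1,
    (1 - max w₁ w₂) * Real.exp (-(p * (1 - w₁))) * Real.exp (-(q * (1 - w₂)))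

lemma dblI_pos (p q : ℝ) : 0 < dblI p q := by
  refine intervalIntegral.intervalIntegral_pos_of_pos_on ?_ (fun w₁ h1 => ?_) one_pos
  · refine Continuous.intervalIntegrable ?_ _ _
    apply intervalIntegral.continuous_parametric_intervalIntegral_of_continuous'
    simp only [Function.uncurry_def]
    fun_prop
  · refine intervalIntegral.intervalIntegral_pos_of_pos_on ?_ (fun w₂ h2 => ?_) one_pos
    · exact Continuous.intervalIntegrable (by fun_prop) _ _
    · have : max w₁ w₂ < 1 := max_lt h1.2 h2.2
      have : 0 < 1 - max w₁ w₂ := by linarith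
      positivity

lemma dbl_mono {f g : ℝ → ℝ → ℝ} (hf : Continuous (Function.uncurry f))
    (hg : Continuous (Function.uncurry g))
    (h : ∀ x ∈ Icc (0:ℝ) 1, ∀ y ∈ Icc (0:ℝ) 1, f x y ≤ g x y) :
    (∫ x in (0:ℝ)..1, ∫ y in (0:ℝ)..1, f x y) ≤ ∫ x in (0:ℝ)..1, ∫ y in (0:ℝ)..1, g x y := by
  refine intervalIntegral.integral_mono_on zero_le_one ?_ ?_ (fun x hx => ?_)
  · exact (intervalIntegral.continuous_parametric_intervalIntegral_of_continuous' hf _ _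
      ).intervalIntegrable _ _
  · exact (intervalIntegral.continuous_parametric_intervalIntegral_of_continuous' hg _ _
      ).intervalIntegrable _ _
  · refine intervalIntegral.integral_mono_on zero_le_one ?_ ?_ (fun y hy => h x hx y hy)
    · exact (hf.comp (by fun_prop : Continuous fun y : ℝ => (x, y))).intervalIntegrable _ _
    · exact (hg.comp (by fun_prop : Continuous fun y : ℝ => (x, y))).intervalIntegrable _ _

lemma dbl_const (c p q : ℝ) : (∫ w₁ in (0:ℝ)..1, ∫ w₂ in (0:ℝ)..1,
    c * ((1 - max w₁ w₂) * Real.exp (-(p * (1 - w₁))) * Real.exp (-(q * (1 - w₂))))) =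
    c * dblI p q := by
  simp only [intervalIntegral.integral_const_mul, dblI]

lemma q_bounds (p q lam a : ℝ) (hlam : 0 < lam) (ha : 0 ≤ a) :
    lam * a * dblI p q ≤ (∫ w₁ in (0:ℝ)..1, ∫ w₂ in (0:ℝ)..1,
      Real.exp (-(p * (1 - w₁))) * Real.exp (-(q * (1 - w₂))) *
        (Real.exp (lam * (1 - max w₁ w₂) * a) - 1)) ∧
    (∫ w₁ in (0:ℝ)..1, ∫ w₂ in (0:ℝ)..1,
      Real.exp (-(p * (1 - w₁))) * Real.exp (-(q * (1 - w₂))) *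
        (Real.exp (lam * (1 - max w₁ w₂) * a) - 1)) ≤
      lam * a * Real.exp (lam * a) * dblI p q := by
  rw [← dbl_const, ← dbl_const]
  constructor
  · refine dbl_mono (by simp only [Function.uncurry_def]; fun_prop)
      (by simp only [Function.uncurry_def]; fun_prop) (fun x _ y _ => ?_)
    have h1 := Real.add_one_le_exp (lam * (1 - max x y) * a)
    calc _ = Real.exp (-(p * (1 - x))) * Real.exp (-(q * (1 - y))) * (lam * (1 - max x y) * a) := by
          ring
      _ ≤ _ := mul_le_mul_of_nonneg_left (by linarith) (by positivity)
  · refine dbl_mono (by simp only [Function.uncurry_def]; fun_prop)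
      (by simp only [Function.uncurry_def]; fun_prop) (fun x hx y hy => ?_)
    set X := lam * (1 - max x y) * a with hX
    have hm1 : max x y ≤ 1 := max_le hx.2 hy.2
    have hm0 : 0 ≤ max x y := le_trans hx.1 (le_max_left _ _)
    have hX0 : 0 ≤ X := mul_nonneg (mul_nonneg hlam.le (by linarith)) ha
    have hXle : X ≤ lam * a := by
      have : lam * a - X = lam * a * max x y := by rw [hX]; ring
      have : 0 ≤ lam * a * max x y := by positivity
      linarith
    have h1 : Real.exp X - 1 ≤ X * Real.exp X := by
      have h2 := Real.add_one_le_exp (-X)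
      have h3 : Real.exp (-X) * Real.exp X = 1 := by rw [← Real.exp_add]; simp
      nlinarith [Real.exp_pos X]
    have h4 : X * Real.exp X ≤ X * Real.exp (lam * a) :=
      mul_le_mul_of_nonneg_left (Real.exp_le_exp.2 hXle) hX0
    calc _ ≤ Real.exp (-(p * (1 - x))) * Real.exp (-(q * (1 - y))) * (X * Real.exp (lam * a)) :=
          mul_le_mul_of_nonneg_left (h1.trans h4) (by positivity)
      _ = _ := by rw [hX]; ring

/-- Retention covariance asymptotics for the random-retained (Matérn type II)
thinning: `q(|z|,r₁,r₂) ∼ q_∞(r₁,r₂) |z|^d F̄(|z|)` as `|z| → ∞`. -/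
theorem stmt18 (d : ℕ) (hd : 0 < d) (lam : ℝ) (hlam : 0 < lam)
    (F : Measure ℝ) [IsProbabilityMeasure F] (hsupp : F (Iio 0) = 0)
    (hmom : Integrable (fun r : ℝ => r ^ d) F)
    (α : ℝ) (hα : (d : ℝ) < α) (hpow : IsPowerLaw F α)
    (r₁ r₂ : ℝ) (hr₁ : 0 ≤ r₁) (hr₂ : 0 ≤ r₂) :
    Tendsto
      (fun z : Euc d =>
        qR d lam F ‖z‖ r₁ r₂ /
          (qinfR d lam α F r₁ r₂ * ‖z‖ ^ d * tailF F ‖z‖))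
      (comap norm atTop) (nhds 1) := by
  refine Tendsto.comp (g := fun u : ℝ => qR d lam F u r₁ r₂ /
    (qinfR d lam α F r₁ r₂ * u ^ d * tailF F u)) ?_ tendsto_comap
  have hc := cconst_pos hd hα
  have hA := aR_tendsto hd hmom hα hpow hr₁ hr₂
  have hA0 : Tendsto (fun u => aR d F u r₁ r₂) atTop (nhds 0) := by
    have h := hA.mul (scale_tendsto_zero hα hpow)
    rw [mul_zero] at h
    refine h.congr' ?_
    filter_upwards [eventually_gt_atTop 0] with u hu
    have := (tailF_pos hpow hu).ne'
    field_simp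
  have hlow : Tendsto (fun u => aR d F u r₁ r₂ / (u ^ d * tailF F u) / cconst d α) atTop
      (nhds 1) := by
    have h := hA.div_const (cconst d α)
    rwa [div_self hc.ne'] at h
  have hup : Tendsto (fun u => Real.exp (lam * aR d F u r₁ r₂) *
      (aR d F u r₁ r₂ / (u ^ d * tailF F u) / cconst d α)) atTop (nhds 1) := by
    have h1 : Tendsto (fun u => Real.exp (lam * aR d F u r₁ r₂)) atTop (nhds 1) := by
      have h2 := (Real.continuous_exp.tendsto (lam * 0)).comp (hA0.const_mul lam)
      simpa [Function.comp_def] using h2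
    simpa using h1.mul hlow
  have hI := dblI_pos (lam * bR d F r₁) (lam * bR d F r₂)
  have hqinf : qinfR d lam α F r₁ r₂ =
    lam * cconst d α * dblI (lam * bR d F r₁) (lam * bR d F r₂) := rfl
  have hq : ∀ᶠ u in atTop, 0 < u ∧
      lam * aR d F u r₁ r₂ * dblI (lam * bR d F r₁) (lam * bR d F r₂) ≤ qR d lam F u r₁ r₂ ∧
      qR d lam F u r₁ r₂ ≤ lam * aR d F u r₁ r₂ * Real.exp (lam * aR d F u r₁ r₂) *
        dblI (lam * bR d F r₁) (lam * bR d F r₂) := by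
    filter_upwards [eventually_gt_atTop (r₁ + r₂), eventually_gt_atTop 0] with u hu hu0
    have ha : 0 ≤ aR d F u r₁ r₂ := integral_nonneg fun s => ENNReal.toReal_nonneg
    have h := q_bounds (lam * bR d F r₁) (lam * bR d F r₂) lam _ hlam ha
    refine ⟨hu0, ?_⟩
    simpa only [qR, if_pos hu] using h
  refine tendsto_of_tendsto_of_tendsto_of_le_of_le' hlow hup ?_ ?_
  · filter_upwards [hq] with u ⟨hu, h1, h2⟩
    have htp := tailF_pos hpow hu
    have hud : 0 < u ^ d := by positivity
    rw [hqinf, le_div_iff₀ (by positivity)]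
    refine le_trans (le_of_eq ?_) h1
    field_simp
  · filter_upwards [hq] with u ⟨hu, h1, h2⟩
    have htp := tailF_pos hpow hu
    have hud : 0 < u ^ d := by positivity
    rw [hqinf, div_le_iff₀ (by positivity)]
    refine h2.trans (le_of_eq ?_)
    field_simp
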